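/- For all integers k ≥ 2 and h ≥ 2, and any tie-breaking rule for Greedy, the maximum flow time of Greedy's schedule on the instance I_k^h equals (2^k − 1)·h − 1. -/

import Mathlib

/-!
# Packet forwarding on a line network

There are `k` active routers `1, …, k`; router `i` forwards packets to router `i+1`.
An instance is a finite collection of packets; packet `p` has a release time `rel p : ℕ`,
a start router `start p ∈ {1, …, k}` and a length `len p ≥ 1` with
`start p + len p − 1 ≤ k`; `p` must be forwarded by routers
`start p, start p + 1, …, start p + len p − 1` in this order.
-/

/-- An instance of online packet forwarding on a line network with `k` active routers.
Packets are indexed by `Fin n`. -/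
structure PInstance (k : ℕ) where
  n : ℕ
  rel : Fin n → ℕ
  start : Fin n → ℕ
  len : Fin n → ℕ

namespace PInstance

variable {k : ℕ}

/-- The instance is well-formed: start routers are at least `1`, lengths are at least `1`,
and every packet fits on the line: `start p + len p − 1 ≤ k`. -/
def Valid (I : PInstance k) : Prop :=
  ∀ p, 1 ≤ I.start p ∧ 1 ≤ I.len p ∧ I.start p + I.len p ≤ k + 1

/-- All packets of the instance have length `1` or `2`. -/
def Short (I : PInstance k) : Prop :=
  ∀ p, I.len p = 1 ∨ I.len p = 2

/-- A schedule assigns to each packet `p` and each hop index `j < len p` (corresponding to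
router `start p + j`) the time step at which that router forwards `p`.  Values at
hop indices `j ≥ len p` are irrelevant. -/
abbrev Sched (I : PInstance k) := Fin I.n → ℕ → ℕ

/-- `arr I S p j` is the time from which hop `j` of packet `p` is available:
packet `p` is available at its start router from time `rel p`, and a packet forwarded
at time `t` is available at the next router from time `t + 1`. -/
def arr (I : PInstance k) (S : Sched I) (p : Fin I.n) : ℕ → ℕ
  | 0 => I.rel p
  | j + 1 => S p j + 1

/-- Feasibility of a schedule: every hop is forwarded no earlier than the time from which
it is available (this includes releases and the order of the hops), and each router
forwards at most one packet in each time step. -/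
def Feasible (I : PInstance k) (S : Sched I) : Prop :=
  (∀ p j, j < I.len p → arr I S p j ≤ S p j) ∧
  (∀ p q jp jq, jp < I.len p → jq < I.len q →
    I.start p + jp = I.start q + jq → S p jp = S q jq → p = q)

/-- Completion time `C(p)`: one plus the time step in which the last router forwards `p`. -/
def comp (I : PInstance k) (S : Sched I) (p : Fin I.n) : ℕ :=
  S p (I.len p - 1) + 1

/-- Flow time of packet `p`: `C(p) − r(p)`. -/
def flowTime (I : PInstance k) (S : Sched I) (p : Fin I.n) : ℕ :=
  comp I S p - I.rel p

/-- Cost of a schedule: the maximum flow time over all packets of the instance. -/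
def cost (I : PInstance k) (S : Sched I) : ℕ :=
  Finset.univ.sup (flowTime I S)

/-- `Opt(I)`: the minimum cost over all feasible schedules. -/
noncomputable def opt (I : PInstance k) : ℕ :=
  sInf {c | ∃ S : Sched I, Feasible I S ∧ cost I S = c}

/-- Hop `j` of packet `p` is waiting (available but not yet forwarded) at time `t`. -/
def Waiting (I : PInstance k) (S : Sched I) (p : Fin I.n) (j t : ℕ) : Prop :=
  j < I.len p ∧ arr I S p j ≤ t ∧ t ≤ S p j

/-- Remaining length `ℓ(p,t)`: the number of routers that still need to forward `p`
at time `t` (under schedule `S`). -/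
noncomputable def remLen (I : PInstance k) (S : Sched I) (p : Fin I.n) (t : ℕ) : ℕ :=
  Set.ncard {j : ℕ | j < I.len p ∧ t ≤ S p j}

/-- Priority `π(p,t) = (t − r(p)) + ℓ(p,t)`. -/
noncomputable def prio (I : PInstance k) (S : Sched I) (p : Fin I.n) (t : ℕ) : ℕ :=
  (t - I.rel p) + remLen I S p t

/-- A schedule is zealous if, at every time step and every router at which some packet
is available (waiting), it forwards a packet there. -/
def Zealous (I : PInstance k) (S : Sched I) : Prop :=
  ∀ t i, (∃ p j, Waiting I S p j t ∧ I.start p + j = i) →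
    ∃ q jq, Waiting I S q jq t ∧ I.start q + jq = i ∧ S q jq = t

/-- `S` is a schedule that Greedy (with some tie-breaking rule) produces: it is feasible,
and in every time step, every router at which at least one packet is waiting forwards a
waiting packet of maximum priority among the packets waiting there. -/
def IsGreedy (I : PInstance k) (S : Sched I) : Prop :=
  Feasible I S ∧
  ∀ t i, (∃ p j, Waiting I S p j t ∧ I.start p + j = i) →
    ∃ q jq, Waiting I S q jq t ∧ I.start q + jq = i ∧ S q jq = t ∧
      ∀ p j, Waiting I S p j t → I.start p + j = i → prio I S p t ≤ prio I S q t

/-- The number of packets released by time `t` that still need to be forwarded by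
router `i` at time `t` under schedule `S`. -/
noncomputable def needs (I : PInstance k) (S : Sched I) (i t : ℕ) : ℕ :=
  Set.ncard {p : Fin I.n | I.rel p ≤ t ∧ ∃ j, j < I.len p ∧ I.start p + j = i ∧ t ≤ S p j}

end PInstance

/-- Build an instance from a list of packets, each given as a triple
(release time, start router, length). -/
def ofTriples (k : ℕ) (L : List (ℕ × ℕ × ℕ)) : PInstance k where
  n := L.length
  rel p := (L.get p).1
  start p := (L.get p).2.1
  len p := (L.get p).2.2

/-- The size `|B_j| = (2^{k−1} − 2^{k−1−j})·h` of block `B_j` of the instance `I_k^h`. -/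
def sizeB (k h j : ℕ) : ℕ := (2 ^ (k - 1) - 2 ^ (k - 1 - j)) * h

/-- The release-time offset `r_i = (Σ_{j=1}^{i-1} |B_j|) + max {0, i − 2}`. -/
def rIdx (k h i : ℕ) : ℕ := (∑ j ∈ Finset.Icc 1 (i - 1), sizeB k h j) + (i - 2)

/-- Block `A_i` (for `1 ≤ i ≤ k − 1`): `2^{k−1−i}·h` packets released at time `r_i` at
router `max {1, i−1}`, of length `1` if `i = 1` and of length `2` if `i ≥ 2`. -/
def blockA (k h i : ℕ) : List (ℕ × ℕ × ℕ) :=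
  List.replicate (2 ^ (k - 1 - i) * h) (rIdx k h i, max 1 (i - 1), if i = 1 then 1 else 2)

/-- Block `B_i` (for `1 ≤ i ≤ k − 1`): `(2^{k−1} − 2^{k−1−i})·h` packets of length `2`
released at time `r_i + 2` at router `i`. -/
def blockB (k h i : ℕ) : List (ℕ × ℕ × ℕ) :=
  List.replicate (sizeB k h i) (rIdx k h i + 2, i, 2)

/-- Block `B_k`: `2^{k−1}·h` packets of length `1` released at time `r_k + 2` at router `k`. -/
def blockBk (k h : ℕ) : List (ℕ × ℕ × ℕ) :=
  List.replicate (2 ^ (k - 1) * h) (rIdx k h k + 2, k, 1)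

/-- The lower-bound instance `I_k^h`: it consists of the blocks `A_i` and `B_i` for
`1 ≤ i ≤ k − 1`, together with the block `B_k`. -/
def Ikh (k h : ℕ) : PInstance k :=
  ofTriples k
    ((((List.range (k - 1)).map (· + 1)).flatMap fun i => blockA k h i ++ blockB k h i)
      ++ blockBk k h)

namespace PInstance

variable {k : ℕ} {I : PInstance k} {S : Sched I}

/-- Packet `p` has to be forwarded by router `i`. -/
def Uses (I : PInstance k) (p : Fin I.n) (i : ℕ) : Prop :=
  I.start p ≤ i ∧ i < I.start p + I.len p

/-- The time step at which router `i` forwards packet `p`. -/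
def svc (I : PInstance k) (S : Sched I) (i : ℕ) (p : Fin I.n) : ℕ :=
  S p (i - I.start p)

theorem Feasible.lt_of_hop_lt (hF : I.Feasible S) {p : Fin I.n} {j' j : ℕ} (h : j' < j)
    (hj : j < I.len p) : S p j' < S p j := by
  induction j, h using Nat.le_induction with
  | base => exact hF.1 p (j' + 1) hj
  | succ m hm ih => exact (ih (by omega)).trans (hF.1 p (m + 1) hj)

theorem Feasible.remLen_eq (hF : I.Feasible S) {p : Fin I.n} {j t : ℕ}
    (hw : I.Waiting S p j t) : I.remLen S p t = I.len p - j := by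
  obtain ⟨hj, ha, ht⟩ := hw
  have hset : {j' : ℕ | j' < I.len p ∧ t ≤ S p j'} = ↑(Finset.Ico j (I.len p)) := by
    ext j'
    simp only [Set.mem_ofPred_eq, Finset.coe_Ico, Set.mem_Ico]
    constructor
    · rintro ⟨h1, h2⟩
      refine ⟨?_, h1⟩
      by_contra! hlt
      obtain ⟨m, rfl⟩ : ∃ m, j = m + 1 := ⟨j - 1, by omega⟩
      have ha' : S p m + 1 ≤ t := ha
      rcases Nat.lt_or_ge j' m with h | h
      · have := hF.lt_of_hop_lt (p := p) h (by omega)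
        omega
      · obtain rfl : j' = m := by omega
        omega
    · rintro ⟨h1, h2⟩
      refine ⟨h2, ?_⟩
      rcases h1.eq_or_lt with rfl | h
      · exact ht
      · exact ht.trans (hF.lt_of_hop_lt h h2).le
  rw [remLen, hset, Set.ncard_coe_finset, Nat.card_Ico]

theorem Feasible.rel_le_svc (hF : I.Feasible S) {p : Fin I.n} {i : ℕ} (hp : I.Uses p i) :
    I.rel p ≤ I.svc S i p := by
  have h0 : I.rel p ≤ S p 0 := hF.1 p 0 (by have := hp.1; have := hp.2; omega)
  rcases Nat.eq_zero_or_pos (i - I.start p) with h | h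
  · rwa [svc, h]
  · exact h0.trans (hF.lt_of_hop_lt h (by have := hp.1; have := hp.2; omega)).le

theorem arr_of_start_eq {p : Fin I.n} {i : ℕ} (h : I.start p = i) :
    I.arr S p (i - I.start p) = I.rel p := by
  simp [h, arr]

theorem arr_succ_of_start_le {p : Fin I.n} {i : ℕ} (h : I.start p ≤ i) :
    I.arr S p (i + 1 - I.start p) = I.svc S i p + 1 := by
  rw [Nat.sub_add_comm h]
  rfl

theorem Feasible.arr_le_svc (hF : I.Feasible S) {p : Fin I.n} {i : ℕ} (hp : I.Uses p i) :
    I.arr S p (i - I.start p) ≤ I.svc S i p :=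
  hF.1 p _ (by have := hp.1; have := hp.2; omega)

theorem Feasible.rel_le_arr (hF : I.Feasible S) {p : Fin I.n} {i : ℕ} (hp : I.Uses p i) :
    I.rel p ≤ I.arr S p (i - I.start p) := by
  rcases hp.1.eq_or_lt with h | h
  · rw [arr_of_start_eq h]
  · obtain ⟨m, rfl⟩ : ∃ m, i = m + 1 := ⟨i - 1, by omega⟩
    rw [arr_succ_of_start_le (by omega)]
    have := hF.rel_le_svc (p := p) (i := m) ⟨by omega, by have := hp.2; omega⟩
    omega

theorem Feasible.svc_inj (hF : I.Feasible S) {p q : Fin I.n} {i : ℕ} (hp : I.Uses p i)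
    (hq : I.Uses q i) (h : I.svc S i p = I.svc S i q) : p = q := by
  obtain ⟨hp1, hp2⟩ := hp
  obtain ⟨hq1, hq2⟩ := hq
  exact hF.2 p q _ _ (by omega) (by omega) (by omega) h

/-- If `p` waits at router `i` at time `t`, then Greedy forwards there a packet whose priority
is at least that of `p`. -/
theorem IsGreedy.exists_svc_eq (hG : I.IsGreedy S) {p : Fin I.n} {i t : ℕ} (hp : I.Uses p i)
    (ha : I.arr S p (i - I.start p) ≤ t) (ht : t ≤ I.svc S i p) :
    ∃ q, I.Uses q i ∧ I.svc S i q = t ∧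
      t + (I.start p + I.len p) + I.rel q ≤ t + (I.start q + I.len q) + I.rel p := by
  have hrp := hG.1.rel_le_arr hp
  have hp1 := hp.1
  have hp2 := hp.2
  have hw : I.Waiting S p (i - I.start p) t := ⟨by omega, ha, ht⟩
  obtain ⟨q, j, hq, hqi, hqt, hmax⟩ := hG.2 t i ⟨p, _, hw, by omega⟩
  have hj : j = i - I.start q := by omega
  subst hj
  have hq1 := hq.1
  have hqu : I.Uses q i := ⟨by omega, by omega⟩
  refine ⟨q, hqu, hqt, ?_⟩
  have h := hmax p _ hw (by omega)
  rw [prio, prio, hG.1.remLen_eq hw, hG.1.remLen_eq hq] at h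
  have hrq := hG.1.rel_le_arr hqu
  have hqa := hq.2.1
  omega

/-- A chain of blocks `A i` and `B i`: the packets of `A i` use the routers `i - 1` and `i`
(only router `1` if `i = 1`) and are released at time `r i`, those of `B i` use the routers `i`
and `i + 1` (only router `k` if `i = k`) and are released at time `r i + 2`.  The block `A i` has
`a i` packets and `B i` has `N - a i` packets, and `F i` is the time at which Greedy starts
forwarding the packets of `A i` at router `i`. -/
structure IsChain (I : PInstance k) (N : ℕ) (a r F : ℕ → ℕ) (A B : ℕ → Finset (Fin I.n)) :
    Prop where
  exhaust : ∀ p, (∃ i, 1 ≤ i ∧ i < k ∧ p ∈ A i) ∨ ∃ i, 1 ≤ i ∧ i ≤ k ∧ p ∈ B i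
  lt_of_mem_A : ∀ {i p}, p ∈ A i → i < k
  rel_A : ∀ {i p}, p ∈ A i → I.rel p = r i
  start_A : ∀ {i p}, p ∈ A i → I.start p = max 1 (i - 1)
  end_A : ∀ {i p}, 1 ≤ i → p ∈ A i → I.start p + I.len p = i + 1
  card_A : ∀ {i}, 1 ≤ i → (A i).card = a i
  rel_B : ∀ {i p}, p ∈ B i → I.rel p = r i + 2
  start_B : ∀ {i p}, p ∈ B i → I.start p = i
  end_B : ∀ {i p}, i ≤ k → p ∈ B i → I.start p + I.len p = min (i + 2) (k + 1)
  card_B : ∀ {i}, 1 ≤ i → i ≤ k → (B i).card = N - a i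
  r_one : r 1 = 0
  r_succ : ∀ {i}, 1 ≤ i → i < k → r (i + 1) = F i + a i
  F_one : F 1 = 0
  F_succ : ∀ {i}, 1 ≤ i → F (i + 1) = F i + N + 1
  two_mul_a_le : ∀ {i}, 1 ≤ i → 2 * a i ≤ N
  two_le_a : ∀ {i}, 1 ≤ i → i < k → 2 ≤ a i
  a_eq : ∀ {i}, 1 ≤ i → i + 1 < k → a i = 2 * a (i + 1)

namespace IsChain

variable {N : ℕ} {a r F : ℕ → ℕ} {A B : ℕ → Finset (Fin I.n)}

theorem r_add_two_le (h : I.IsChain N a r F A B) {i : ℕ} (hi : 1 ≤ i) (hik : i < k) :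
    r i + 2 ≤ r (i + 1) := by
  have h1 := h.r_succ hi hik
  have h2 := h.two_le_a hi hik
  rcases hi.eq_or_lt with rfl | hi'
  · have := h.r_one
    omega
  · obtain ⟨m, rfl⟩ : ∃ m, i = m + 1 := ⟨i - 1, by omega⟩
    have h3 := h.r_succ (i := m) (by omega) (by omega)
    have h4 := h.F_succ (i := m) (by omega)
    have h5 := h.two_mul_a_le (i := m) (by omega)
    omega

theorem r_add_three_le (h : I.IsChain N a r F A B) {i : ℕ} (hi : 1 ≤ i) (hik : i + 1 < k) :
    r i + 3 ≤ r (i + 1) := by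
  have h1 := h.r_succ hi (by omega)
  have h2 := h.two_le_a (i := i + 1) (by omega) hik
  have h6 := h.a_eq hi hik
  rcases hi.eq_or_lt with rfl | hi'
  · have := h.r_one
    omega
  · obtain ⟨m, rfl⟩ : ∃ m, i = m + 1 := ⟨i - 1, by omega⟩
    have h3 := h.r_succ (i := m) (by omega) (by omega)
    have h4 := h.F_succ (i := m) (by omega)
    have h5 := h.two_mul_a_le (i := m) (by omega)
    omega

theorem r_add_two_le_F (h : I.IsChain N a r F A B) {i : ℕ} (hi : 1 ≤ i) (hik : i ≤ k)
    (hk : 2 ≤ k) : r i + 2 ≤ F i + a i := by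
  rcases hi.eq_or_lt with rfl | hi'
  · have := h.r_one
    have := h.two_le_a (i := 1) le_rfl (by omega)
    omega
  · obtain ⟨m, rfl⟩ : ∃ m, i = m + 1 := ⟨i - 1, by omega⟩
    have h2 := h.two_le_a (i := m) (by omega) (by omega)
    have h3 := h.r_succ (i := m) (by omega) (by omega)
    have h4 := h.F_succ (i := m) (by omega)
    have h5 := h.two_mul_a_le (i := m) (by omega)
    omega

theorem uses_A (h : I.IsChain N a r F A B) {i : ℕ} {p : Fin I.n} (hi : 1 ≤ i) (hp : p ∈ A i) :
    I.Uses p i := by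
  have := h.start_A hp
  have := h.end_A hi hp
  constructor <;> omega

theorem uses_A_pred (h : I.IsChain N a r F A B) {i : ℕ} {p : Fin I.n} (hi : 1 ≤ i)
    (hp : p ∈ A (i + 1)) : I.Uses p i := by
  have := h.start_A hp
  have := h.end_A (by omega) hp
  constructor <;> omega

theorem uses_B (h : I.IsChain N a r F A B) {i : ℕ} {p : Fin I.n} (hik : i ≤ k) (hp : p ∈ B i) :
    I.Uses p i := by
  have := h.start_B hp
  have := h.end_B hik hp
  constructor <;> omega

theorem uses_B_succ (h : I.IsChain N a r F A B) {i : ℕ} {p : Fin I.n} (hik : i < k)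
    (hp : p ∈ B i) : I.Uses p (i + 1) := by
  have := h.start_B hp
  have := h.end_B hik.le hp
  constructor <;> omega

/-- The packets that use router `i` belong to `B (i - 1)`, `A i`, `B i` or `A (i + 1)`. -/
theorem mem_of_uses (h : I.IsChain N a r F A B) {i : ℕ} {p : Fin I.n} (hp : I.Uses p i) :
    (2 ≤ i ∧ p ∈ B (i - 1)) ∨ p ∈ A i ∨ p ∈ B i ∨ p ∈ A (i + 1) := by
  obtain ⟨h1, h2⟩ := hp
  rcases h.exhaust p with ⟨j, hj, hjk, hm⟩ | ⟨j, hj, hjk, hm⟩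
  · have h3 := h.start_A hm
    have h4 := h.end_A hj hm
    obtain rfl | rfl : j = i ∨ j = i + 1 := by omega
    · exact .inr (.inl hm)
    · exact .inr (.inr (.inr hm))
  · have h3 := h.start_B hm
    have h4 := h.end_B hjk hm
    obtain rfl | rfl : j = i ∨ i = j + 1 := by omega
    · exact .inr (.inr (.inl hm))
    · exact .inl ⟨by omega, hm⟩

end IsChain

theorem image_eq_Ico_of_consecutive {α : Type*} (X : Finset α) (s : α → ℕ)
    (T : ℕ) (hs : ∀ x ∈ X, ∀ y ∈ X, s x = s y → x = y) (hT : ∀ x ∈ X, T ≤ s x)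
    (hX : ∀ x ∈ X, ∀ t, T ≤ t → t ≤ s x → ∃ y ∈ X, s y = t) :
    X.image s = Finset.Ico T (T + X.card) := by
  have hcard : (X.image s).card = X.card := Finset.card_image_of_injOn hs
  refine Finset.eq_of_subset_of_card_le ?_ (by simp [hcard])
  intro u hu
  obtain ⟨x, hx, rfl⟩ := Finset.mem_image.1 hu
  refine Finset.mem_Ico.2 ⟨hT x hx, ?_⟩
  have hsub : Finset.Icc T (s x) ⊆ X.image s := by
    intro t ht
    rw [Finset.mem_Icc] at ht
    exact Finset.mem_image.2 (hX x hx t ht.1 ht.2)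
  have := Finset.card_le_card hsub
  rw [hcard, Nat.card_Icc] at this
  omega

namespace IsChain

variable {N : ℕ} {a r F : ℕ → ℕ} {A B : ℕ → Finset (Fin I.n)}

/-- The packets that reach router `i` from router `i - 1`, as well as those of `A 1` at
router `1`, are forwarded by router `i` during the expected time intervals. -/
def Inflow (I : PInstance k) (S : Sched I) (a r F : ℕ → ℕ) (A B : ℕ → Finset (Fin I.n))
    (i : ℕ) : Prop :=
  (A i).image (I.svc S i) = Finset.Ico (F i) (F i + a i) ∧
    (2 ≤ i → (B (i - 1)).image (I.svc S i) = Finset.Ico (r i + 1) (F i))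

theorem Inflow.svc_lt_of_mem_A {i : ℕ} (hP : Inflow I S a r F A B i) {p : Fin I.n}
    (hp : p ∈ A i) : I.svc S i p < F i + a i := by
  have := Finset.mem_image_of_mem (I.svc S i) hp
  rw [hP.1, Finset.mem_Ico] at this
  exact this.2

theorem Inflow.svc_lt_of_mem_B {i : ℕ} (hP : Inflow I S a r F A B i) (hi : 2 ≤ i) {p : Fin I.n}
    (hp : p ∈ B (i - 1)) : I.svc S i p < F i := by
  have := Finset.mem_image_of_mem (I.svc S i) hp
  rw [hP.2 hi, Finset.mem_Ico] at this
  exact this.2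

theorem inflow_one (h : I.IsChain N a r F A B) (hG : I.IsGreedy S) (hk : 2 ≤ k) :
    Inflow I S a r F A B 1 := by
  refine ⟨?_, by omega⟩
  rw [← h.card_A le_rfl, h.F_one]
  refine image_eq_Ico_of_consecutive _ _ _
    (fun x hx y hy => hG.1.svc_inj (h.uses_A le_rfl hx) (h.uses_A le_rfl hy))
    (fun _ _ => Nat.zero_le _) fun x hx t _ hts => ?_
  have hsx := h.start_A hx
  have hrx := h.rel_A hx
  have hex := h.end_A le_rfl hx
  have hr1 := h.r_one
  have hr2 := h.r_add_two_le (i := 1) le_rfl (by omega)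
  obtain ⟨q, hq, hqt, hpr⟩ := hG.exists_svc_eq (t := t) (h.uses_A le_rfl hx)
    (by rw [arr_of_start_eq (by simpa using hsx)]; omega) hts
  rcases h.mem_of_uses hq with ⟨h2, _⟩ | hm | hm | hm
  · omega
  · exact ⟨q, hm, hqt⟩
  · have := h.rel_B hm
    have := h.end_B (by omega) hm
    omega
  · have := h.rel_A hm
    have := h.end_A (by omega) hm
    omega

theorem image_svc_B (h : I.IsChain N a r F A B) (hG : I.IsGreedy S) (hk : 2 ≤ k) {i : ℕ}
    (hi : 1 ≤ i) (hik : i ≤ k) (hP : Inflow I S a r F A B i) :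
    (B i).image (I.svc S i) = Finset.Ico (F i + a i) (F i + N) := by
  have hle := h.two_mul_a_le hi
  have hrF := h.r_add_two_le_F hi hik hk
  have hN : F i + N = F i + a i + (B i).card := by
    rw [h.card_B hi hik]
    omega
  rw [hN]
  refine image_eq_Ico_of_consecutive _ _ _
    (fun x hx y hy => hG.1.svc_inj (h.uses_B hik hx) (h.uses_B hik hy)) (fun x hx => ?_)
    fun x hx t ht hts => ?_
  · by_contra! hlt
    have hux := h.uses_B hik hx
    have hrx := h.rel_B hx
    have hsx := h.start_B hx
    have hex := h.end_B hik hx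
    have hge := hG.1.rel_le_svc hux
    rcases Nat.lt_or_ge (I.svc S i x) (F i) with hF | hF
    · have hi2 : 2 ≤ i := by
        by_contra! hi2
        obtain rfl : i = 1 := by omega
        have := h.F_one
        omega
      have hmem : I.svc S i x ∈ Finset.Ico (r i + 1) (F i) := Finset.mem_Ico.2 ⟨by omega, hF⟩
      rw [← hP.2 hi2] at hmem
      obtain ⟨y, hy, hyx⟩ := Finset.mem_image.1 hmem
      have hy' := h.uses_B_succ (by omega) hy
      rw [Nat.sub_add_cancel hi] at hy'
      obtain rfl := hG.1.svc_inj hy' hux hyx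
      have := h.start_B hy
      omega
    · have hmem : I.svc S i x ∈ Finset.Ico (F i) (F i + a i) := Finset.mem_Ico.2 ⟨hF, hlt⟩
      rw [← hP.1] at hmem
      obtain ⟨y, hy, hyx⟩ := Finset.mem_image.1 hmem
      obtain rfl := hG.1.svc_inj (h.uses_A hi hy) hux hyx
      have := h.lt_of_mem_A hy
      have := h.end_A hi hy
      omega
  · have hrx := h.rel_B hx
    have hsx := h.start_B hx
    have hex := h.end_B hik hx
    obtain ⟨q, hq, hqt, hpr⟩ := hG.exists_svc_eq (t := t) (h.uses_B hik hx)
      (by rw [arr_of_start_eq hsx]; omega) hts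
    rcases h.mem_of_uses hq with ⟨h2, hm⟩ | hm | hm | hm
    · have := hP.svc_lt_of_mem_B h2 hm
      omega
    · have := hP.svc_lt_of_mem_A hm
      omega
    · exact ⟨q, hm, hqt⟩
    · have hlt := h.lt_of_mem_A hm
      have := h.rel_A hm
      have := h.end_A (by omega) hm
      have := h.r_add_three_le hi hlt
      omega

theorem image_svc_A_succ (h : I.IsChain N a r F A B) (hG : I.IsGreedy S) (hk : 2 ≤ k) {i : ℕ}
    (hi : 1 ≤ i) (hik : i < k) (hP : Inflow I S a r F A B i) :
    (A (i + 1)).image (I.svc S i) = Finset.Ico (F i + N) (F i + N + a (i + 1)) := by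
  have hB := h.image_svc_B hG hk hi hik.le hP
  have hle := h.two_mul_a_le hi
  have hr := h.r_succ hi hik
  rw [← h.card_A (i := i + 1) (by omega)]
  refine image_eq_Ico_of_consecutive _ _ _
    (fun x hx y hy => hG.1.svc_inj (h.uses_A_pred hi hx) (h.uses_A_pred hi hy)) (fun x hx => ?_)
    fun x hx t ht hts => ?_
  · by_contra! hlt
    have hux := h.uses_A_pred hi hx
    have hrx := h.rel_A hx
    have hge := hG.1.rel_le_svc hux
    have hmem : I.svc S i x ∈ Finset.Ico (F i + a i) (F i + N) :=
      Finset.mem_Ico.2 ⟨by omega, hlt⟩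
    rw [← hB] at hmem
    obtain ⟨y, hy, hyx⟩ := Finset.mem_image.1 hmem
    obtain rfl := hG.1.svc_inj (h.uses_B hik.le hy) hux hyx
    have := h.rel_B hy
    have := h.r_add_three_le hi (h.lt_of_mem_A hx)
    omega
  · have hrx := h.rel_A hx
    have hsx := h.start_A hx
    obtain ⟨q, hq, hqt, hpr⟩ := hG.exists_svc_eq (t := t) (h.uses_A_pred hi hx)
      (by rw [arr_of_start_eq (by omega)]; omega) hts
    rcases h.mem_of_uses hq with ⟨h2, hm⟩ | hm | hm | hm
    · have := hP.svc_lt_of_mem_B h2 hm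
      omega
    · have := hP.svc_lt_of_mem_A hm
      omega
    · have := Finset.mem_image_of_mem (I.svc S i) hm
      rw [hB, Finset.mem_Ico] at this
      omega
    · exact ⟨q, hm, hqt⟩

/-- Router `i + 1` forwards the packets it receives from router `i` as soon as they arrive. -/
theorem svc_succ_eq (h : I.IsChain N a r F A B) (hG : I.IsGreedy S) {i : ℕ}
    (hi : 1 ≤ i) (hik : i < k) {p : Fin I.n} (hp : p ∈ B i ∨ p ∈ A (i + 1)) :
    I.svc S (i + 1) p = I.svc S i p + 1 := by
  have uses : ∀ {q}, q ∈ B i ∨ q ∈ A (i + 1) → I.Uses q i ∧ I.Uses q (i + 1) := by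
    rintro q (hq | hq)
    · exact ⟨h.uses_B hik.le hq, h.uses_B_succ hik hq⟩
    · exact ⟨h.uses_A_pred hi hq, h.uses_A (by omega) hq⟩
  induction ht : I.svc S i p using Nat.strong_induction_on generalizing p with
  | _ t ih =>
  obtain ⟨hu, hu'⟩ := uses hp
  have harr := arr_succ_of_start_le (S := S) hu.1
  have hle := hG.1.arr_le_svc hu'
  obtain ⟨q, hq, hqt, hpr⟩ := hG.exists_svc_eq (t := t + 1) hu' (by omega) (by omega)
  have hq' : q ∈ B i ∨ q ∈ A (i + 1) := by
    have hr2 := h.r_add_two_le hi hik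
    rcases h.mem_of_uses hq with ⟨_, hm⟩ | hm | hm | hm
    · exact .inl hm
    · exact .inr hm
    · exfalso
      have := h.rel_B hm
      have := h.end_B (by omega) hm
      rcases hp with hp | hp
      · have := h.rel_B hp
        have := h.end_B hik.le hp
        omega
      · have := h.rel_A hp
        have := h.end_A (by omega) hp
        omega
    · exfalso
      have := h.rel_A hm
      have := h.end_A (by omega) hm
      have := h.r_add_three_le (i := i + 1) (by omega) (h.lt_of_mem_A hm)
      rcases hp with hp | hp
      · have := h.rel_B hp
        have := h.end_B hik.le hp
        omega
      · have := h.rel_A hp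
        have := h.end_A (by omega) hp
        omega
  obtain ⟨hv, hv'⟩ := uses hq'
  have harrq := arr_succ_of_start_le (S := S) hv.1
  have hleq := hG.1.arr_le_svc hv'
  rcases Nat.lt_or_ge (I.svc S i q) t with hlt | hge
  · have := ih _ hlt hq' rfl
    omega
  · obtain rfl := hG.1.svc_inj hv hu (by omega)
    exact hqt

theorem inflow (h : I.IsChain N a r F A B) (hG : I.IsGreedy S) (hk : 2 ≤ k) {i : ℕ}
    (hi : 1 ≤ i) (hik : i ≤ k) : Inflow I S a r F A B i := by
  induction i, hi using Nat.le_induction with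
  | base => exact h.inflow_one hG hk
  | succ i hi ih =>
    have hP := ih (by omega)
    have shift : ∀ {X : Finset (Fin I.n)} {u v : ℕ},
        (∀ p ∈ X, I.svc S (i + 1) p = I.svc S i p + 1) →
        X.image (I.svc S i) = Finset.Ico u v →
        X.image (I.svc S (i + 1)) = Finset.Ico (u + 1) (v + 1) := by
      intro X u v hX hI
      rw [Finset.image_congr (g := (· + 1) ∘ I.svc S i) hX, ← Finset.image_image, hI,
        Finset.image_add_right_Ico]
    have hA := shift (fun p hp => h.svc_succ_eq hG hi hik (.inr hp))
      (h.image_svc_A_succ hG hk hi hik hP)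
    have hB := shift (fun p hp => h.svc_succ_eq hG hi hik (.inl hp))
      (h.image_svc_B hG hk hi (by omega) hP)
    have hF := h.F_succ hi
    have hr := h.r_succ hi hik
    refine ⟨?_, fun _ => ?_⟩
    · rw [hA, hF]
      congr 1
      omega
    · rw [Nat.add_sub_cancel, hB, hF, hr]

theorem comp_eq {p : Fin I.n} {i : ℕ} (hi : I.start p + I.len p = i + 1) :
    I.comp S p = I.svc S i p + 1 := by
  rw [comp, svc]
  congr 2
  omega

theorem a_pred_le (h : I.IsChain N a r F A B) {i : ℕ} (hi : 1 ≤ i) (hik : i < k) :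
    a (k - 1) ≤ a i := by
  have hik' : i ≤ k - 1 := by omega
  induction hik' using Nat.decreasingInduction with
  | self => exact le_rfl
  | of_succ i hik' ih =>
    have := ih (by omega) (by omega)
    have := h.a_eq hi (by omega)
    omega

theorem flowTime_le (h : I.IsChain N a r F A B) (hG : I.IsGreedy S) (hk : 2 ≤ k)
    (p : Fin I.n) : I.flowTime S p ≤ 2 * N - a (k - 1) - 1 := by
  have ha := h.two_le_a (i := k - 1) (by omega) (by omega)
  have haN := h.two_mul_a_le (i := k - 1) (by omega)
  rw [flowTime]
  rcases h.exhaust p with ⟨i, hi, hik, hp⟩ | ⟨i, hi, hik, hp⟩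
  · rw [comp_eq (h.end_A hi hp), h.rel_A hp]
    have hlt := (h.inflow hG hk hi hik.le).svc_lt_of_mem_A hp
    have hai := h.two_mul_a_le hi
    rcases hi.eq_or_lt with rfl | hi'
    · have := h.F_one
      omega
    · obtain ⟨m, rfl⟩ : ∃ m, i = m + 1 := ⟨i - 1, by omega⟩
      have := h.r_succ (i := m) (by omega) (by omega)
      have := h.F_succ (i := m) (by omega)
      have := h.a_eq (i := m) (by omega) hik
      omega
  · have hlt : I.comp S p ≤ F i + N + (if i = k then 0 else 1) := by
      have hP := h.inflow hG hk hi hik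
      have he := h.end_B hik hp
      split_ifs with hc
      · rw [comp_eq (i := i) (by omega)]
        have hmem := Finset.mem_image_of_mem (I.svc S i) hp
        rw [h.image_svc_B hG hk hi hik hP, Finset.mem_Ico] at hmem
        omega
      · rw [comp_eq (i := i + 1) (by omega)]
        have hF := h.F_succ hi
        have := (h.inflow hG hk (i := i + 1) (by omega) (by omega)).svc_lt_of_mem_B
          (by omega) hp
        omega
    rw [h.rel_B hp]
    rcases hi.eq_or_lt with rfl | hi'
    · have := h.F_one
      split_ifs at hlt <;> omega
    · obtain ⟨m, rfl⟩ : ∃ m, i = m + 1 := ⟨i - 1, by omega⟩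
      have := h.r_succ (i := m) (by omega) (by omega)
      have := h.F_succ (i := m) (by omega)
      split_ifs at hlt with hc
      · obtain rfl : m = k - 1 := by omega
        omega
      · have := h.a_eq (i := m) (by omega) (by omega)
        have := h.a_pred_le (i := m + 1) (by omega) (by omega)
        omega

/-- The cost of Greedy on a chain of blocks. -/
theorem cost_eq (h : I.IsChain N a r F A B) (hG : I.IsGreedy S) (hk : 2 ≤ k) :
    I.cost S = 2 * N - a (k - 1) - 1 := by
  refine le_antisymm (Finset.sup_le fun p _ => h.flowTime_le hG hk p) ?_
  have ha := h.two_le_a (i := k - 1) (by omega) (by omega)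
  have haN := h.two_mul_a_le (i := k - 1) (by omega)
  have hak := h.two_mul_a_le (i := k) (by omega)
  have hF := h.F_succ (i := k - 1) (by omega)
  have hr := h.r_succ (i := k - 1) (by omega) (by omega)
  rw [Nat.sub_add_cancel (by omega : 1 ≤ k)] at hF hr
  have hmem : F k + N - 1 ∈ Finset.Ico (F k + a k) (F k + N) :=
    Finset.mem_Ico.2 (by omega)
  rw [← h.image_svc_B hG hk (by omega) le_rfl (h.inflow hG hk (by omega) le_rfl)] at hmem
  obtain ⟨p, hp, hpt⟩ := Finset.mem_image.1 hmem
  have he := h.end_B le_rfl hp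
  have hle : I.flowTime S p ≤ I.cost S := Finset.le_sup (Finset.mem_univ p)
  rw [flowTime, comp_eq (i := k) (by omega), hpt, h.rel_B hp] at hle
  omega

end IsChain

end PInstance

/-- The number of packets of block `A_i` of the instance `I_k^h`, which is `0` for `i ≥ k`. -/
def sizeA (k h i : ℕ) : ℕ := if i < k then 2 ^ (k - 1 - i) * h else 0

/-- The triple describing the packets of block `A_i`. -/
def tripleA (k h i : ℕ) : ℕ × ℕ × ℕ := (rIdx k h i, max 1 (i - 1), if i = 1 then 1 else 2)

/-- The triple describing the packets of block `B_i`. -/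
def tripleB (k h i : ℕ) : ℕ × ℕ × ℕ := (rIdx k h i + 2, i, if i = k then 1 else 2)

/-- The list of packets of the instance `I_k^h`. -/
def packetList (k h : ℕ) : List (ℕ × ℕ × ℕ) :=
  (((List.range (k - 1)).map (· + 1)).flatMap fun i => blockA k h i ++ blockB k h i)
    ++ blockBk k h

theorem sizeB_add_sizeA {k h i : ℕ} (hik : i < k) :
    sizeB k h i + sizeA k h i = 2 ^ (k - 1) * h := by
  rw [sizeB, sizeA, if_pos hik, ← add_mul,
    Nat.sub_add_cancel (Nat.pow_le_pow_right (by omega) (by omega))]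

theorem sizeA_eq_two_mul {k h i : ℕ} (hik : i + 1 < k) :
    sizeA k h i = 2 * sizeA k h (i + 1) := by
  rw [sizeA, sizeA, if_pos (by omega), if_pos hik, show k - 1 - i = k - 1 - (i + 1) + 1 by omega]
  ring

theorem le_sizeA {k h i : ℕ} (hik : i < k) : h ≤ sizeA k h i := by
  rw [sizeA, if_pos hik]
  exact Nat.le_mul_of_pos_left _ (by positivity)

theorem two_mul_sizeA_le {k h i : ℕ} (hi : 1 ≤ i) : 2 * sizeA k h i ≤ 2 ^ (k - 1) * h := by
  rw [sizeA]
  split_ifs with hik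
  · rw [← mul_assoc, ← pow_succ']
    exact Nat.mul_le_mul_right _ (Nat.pow_le_pow_right (by omega) (by omega))
  · omega

theorem rIdx_one (k h : ℕ) : rIdx k h 1 = 0 := by simp [rIdx]

theorem rIdx_succ_add {k h i : ℕ} (hi : 2 ≤ i) :
    rIdx k h (i + 1) = rIdx k h i + sizeB k h i + 1 := by
  obtain ⟨m, rfl⟩ : ∃ m, i = m + 2 := ⟨i - 2, by omega⟩
  simp only [rIdx, Nat.add_sub_cancel, show m + 2 - 1 = m + 1 by omega,
    show m + 2 + 1 - 2 = m + 1 by omega]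
  rw [Finset.sum_Icc_succ_top (by omega)]
  simp only [add_assoc, Nat.reduceAdd]
  omega

theorem rIdx_succ {k h i : ℕ} (hi : 1 ≤ i) (hik : i < k) :
    rIdx k h (i + 1) = (i - 1) * (2 ^ (k - 1) * h + 1) + sizeA k h i := by
  induction i, hi using Nat.le_induction with
  | base =>
    have h1 := sizeB_add_sizeA (h := h) hik
    have h2 : sizeA k h 1 * 2 = 2 ^ (k - 1) * h := by
      rw [sizeA, if_pos hik, mul_right_comm, ← pow_succ]
      congr 2
      omega
    simp only [rIdx, Nat.add_sub_cancel, Finset.Icc_self, Finset.sum_singleton]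
    omega
  | succ i hi ih =>
    have h1 := sizeB_add_sizeA (h := h) hik
    have h2 := sizeA_eq_two_mul (h := h) hik
    rw [rIdx_succ_add (by omega), ih (by omega)]
    obtain ⟨m, rfl⟩ : ∃ m, i = m + 1 := ⟨i - 1, by omega⟩
    simp only [Nat.add_sub_cancel, add_mul] at *
    omega

theorem mem_packetList {k h : ℕ} {x : ℕ × ℕ × ℕ} (hk : 1 ≤ k) (hx : x ∈ packetList k h) :
    (∃ i, 1 ≤ i ∧ i < k ∧ x = tripleA k h i) ∨ ∃ i, 1 ≤ i ∧ i ≤ k ∧ x = tripleB k h i := by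
  simp only [packetList, blockA, blockB, blockBk, List.mem_append, List.mem_flatMap, List.mem_map,
    List.mem_range, List.mem_replicate] at hx
  rcases hx with ⟨_, ⟨j, hj, rfl⟩, ⟨_, rfl⟩ | ⟨_, rfl⟩⟩ | ⟨_, rfl⟩
  · exact .inl ⟨j + 1, by omega, by omega, rfl⟩
  · exact .inr ⟨j + 1, by omega, by omega, by rw [tripleB, if_neg (by omega)]⟩
  · exact .inr ⟨k, hk, le_rfl, by rw [tripleB, if_pos rfl]⟩

theorem count_packetList (k h : ℕ) (x : ℕ × ℕ × ℕ) :
    (packetList k h).count x =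
      ∑ j ∈ Finset.range (k - 1), ((if tripleA k h (j + 1) = x then sizeA k h (j + 1) else 0) +
        if tripleB k h (j + 1) = x then sizeB k h (j + 1) else 0) +
      if tripleB k h k = x then 2 ^ (k - 1) * h else 0 := by
  rw [packetList, List.count_append, List.count_flatMap, List.map_map,
    blockBk, List.count_replicate]
  congr 1
  · change ∑ j ∈ Finset.range (k - 1),
      (List.count x ∘ fun i => blockA k h i ++ blockB k h i) (j + 1) = _
    refine Finset.sum_congr rfl fun j hj => ?_
    rw [Finset.mem_range] at hj
    simp only [Function.comp_apply, blockA, blockB, List.count_append, List.count_replicate,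
      beq_iff_eq]
    rw [tripleA, tripleB, sizeA, if_pos (by omega : j + 1 < k), if_neg (by omega : j + 1 ≠ k)]
  · rw [tripleB, if_pos rfl]
    simp only [beq_iff_eq]

theorem tripleA_inj {k h i j : ℕ} (hi : 1 ≤ i) (hj : 1 ≤ j)
    (hij : tripleA k h i = tripleA k h j) : i = j := by
  simp only [tripleA, Prod.mk.injEq] at hij
  obtain ⟨-, h2, h3⟩ := hij
  split_ifs at h3 <;> omega

theorem tripleB_inj {k h i j : ℕ} (hij : tripleB k h i = tripleB k h j) : i = j := by
  simp only [tripleB, Prod.mk.injEq] at hij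
  exact hij.2.1

theorem tripleA_ne_tripleB {k h i j : ℕ} (hh : 2 ≤ h) (hi : 1 ≤ i) (hik : i < k) :
    tripleA k h i ≠ tripleB k h j := by
  intro hij
  simp only [tripleA, tripleB, Prod.mk.injEq] at hij
  obtain ⟨h1, h2, h3⟩ := hij
  split_ifs at h3 with h4 h5 h5
  · omega
  · omega
  · omega
  · have hj : i = j + 1 := by omega
    subst hj
    have ha := le_sizeA (h := h) hik
    have ha' := sizeA_eq_two_mul (h := h) hik
    rcases (show 1 ≤ j by omega).eq_or_lt with rfl | hj
    · rw [rIdx_succ le_rfl (by omega), rIdx_one] at h1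
      omega
    · rw [rIdx_succ_add (by omega)] at h1
      have := sizeB_add_sizeA (k := k) (h := h) (i := j) (by omega)
      have := two_mul_sizeA_le (k := k) (h := h) (i := j) (by omega)
      omega

theorem count_tripleA {k h i : ℕ} (hh : 2 ≤ h) (hi : 1 ≤ i) (hik : i < k) :
    (packetList k h).count (tripleA k h i) = sizeA k h i := by
  rw [count_packetList, Finset.sum_eq_single (i - 1), Nat.sub_add_cancel hi, if_pos rfl,
    if_neg (tripleA_ne_tripleB hh hi hik).symm, if_neg (tripleA_ne_tripleB hh hi hik).symm]
  · rfl
  · intro j _ hj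
    rw [if_neg fun he => hj (by have := tripleA_inj (by omega) hi he; omega),
      if_neg (tripleA_ne_tripleB hh hi hik).symm, add_zero]
  · intro hn
    rw [Finset.mem_range] at hn
    omega

theorem count_tripleB {k h i : ℕ} (hh : 2 ≤ h) (hi : 1 ≤ i) (hik : i ≤ k) :
    (packetList k h).count (tripleB k h i) = 2 ^ (k - 1) * h - sizeA k h i := by
  rw [count_packetList]
  rcases hik.eq_or_lt with rfl | hik
  · rw [Finset.sum_eq_zero, if_pos rfl, sizeA, if_neg (lt_irrefl _)]
    · omega
    · intro j hj
      rw [Finset.mem_range] at hj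
      rw [if_neg (tripleA_ne_tripleB hh (by omega) (by omega)),
        if_neg fun he => by have := tripleB_inj he; omega, add_zero]
  · have := sizeB_add_sizeA (h := h) hik
    rw [Finset.sum_eq_single (i - 1), Nat.sub_add_cancel hi, if_pos rfl,
      if_neg (tripleA_ne_tripleB hh hi hik), if_neg fun he => by have := tripleB_inj he; omega]
    · omega
    · intro j hj hji
      rw [Finset.mem_range] at hj
      rw [if_neg (tripleA_ne_tripleB hh (by omega) (by omega)),
        if_neg fun he => hji (by have := tripleB_inj he; omega), add_zero]
    · intro hn
      rw [Finset.mem_range] at hn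
      omega

theorem card_filter_get_eq_count {α : Type*} [DecidableEq α] (L : List α) (x : α) :
    (Finset.univ.filter fun p : Fin L.length => L.get p = x).card = L.count x := by
  simpa [List.Vector.get, eq_comm] using
    Fin.card_filter_univ_eq_vector_get_eq_count x (⟨L, rfl⟩ : List.Vector α L.length)

/-- The packets of the instance `I_k^h` described by the triple `x`. -/
def packetsOf (k h : ℕ) (x : ℕ × ℕ × ℕ) : Finset (Fin (Ikh k h).n) :=
  Finset.univ.filter fun p => ((Ikh k h).rel p, (Ikh k h).start p, (Ikh k h).len p) = x

theorem mem_packetsOf {k h : ℕ} {x : ℕ × ℕ × ℕ} {p : Fin (Ikh k h).n} :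
    p ∈ packetsOf k h x ↔ ((Ikh k h).rel p, (Ikh k h).start p, (Ikh k h).len p) = x :=
  Finset.mem_filter_univ p

theorem card_packetsOf (k h : ℕ) (x : ℕ × ℕ × ℕ) :
    (packetsOf k h x).card = (packetList k h).count x := by
  rw [lawful_beq_subsingleton instBEqProd instBEqOfDecidableEq]
  exact card_filter_get_eq_count (packetList k h) x

theorem isChain_Ikh {k h : ℕ} (hk : 2 ≤ k) (hh : 2 ≤ h) :
    (Ikh k h).IsChain (2 ^ (k - 1) * h) (sizeA k h) (rIdx k h)
      (fun i => (i - 1) * (2 ^ (k - 1) * h + 1))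
      (fun i => if i < k then packetsOf k h (tripleA k h i) else ∅)
      (fun i => packetsOf k h (tripleB k h i)) := by
  have mem_A : ∀ {i : ℕ} {p : Fin (Ikh k h).n},
      p ∈ (if i < k then packetsOf k h (tripleA k h i) else ∅) →
      i < k ∧ (Ikh k h).rel p = rIdx k h i ∧ (Ikh k h).start p = max 1 (i - 1) ∧
        (Ikh k h).len p = if i = 1 then 1 else 2 := by
    intro i p hp
    split_ifs at hp with hik
    · rw [mem_packetsOf, tripleA, Prod.mk.injEq, Prod.mk.injEq] at hp
      exact ⟨hik, hp⟩
    · simp at hp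
  have mem_B : ∀ {i : ℕ} {p : Fin (Ikh k h).n}, p ∈ packetsOf k h (tripleB k h i) →
      (Ikh k h).rel p = rIdx k h i + 2 ∧ (Ikh k h).start p = i ∧
        (Ikh k h).len p = if i = k then 1 else 2 := by
    intro i p hp
    rwa [mem_packetsOf, tripleB, Prod.mk.injEq, Prod.mk.injEq] at hp
  constructor
  case exhaust =>
    intro p
    refine (mem_packetList (by omega) (List.get_mem (packetList k h) p)).imp ?_ ?_
    · rintro ⟨i, hi, hik, he⟩
      exact ⟨i, hi, hik, by rw [if_pos hik]; exact mem_packetsOf.2 he⟩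
    · rintro ⟨i, hi, hik, he⟩
      exact ⟨i, hi, hik, mem_packetsOf.2 he⟩
  case lt_of_mem_A => exact fun hp => (mem_A hp).1
  case rel_A => exact fun hp => (mem_A hp).2.1
  case start_A => exact fun hp => (mem_A hp).2.2.1
  case end_A =>
    intro i p hi hp
    obtain ⟨_, _, h1, h2⟩ := mem_A hp
    split_ifs at h2 <;> omega
  case card_A =>
    intro i hi
    split_ifs with hik
    · rw [card_packetsOf, count_tripleA hh hi hik]
    · rw [sizeA, if_neg hik, Finset.card_empty]
  case rel_B => exact fun hp => (mem_B hp).1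
  case start_B => exact fun hp => (mem_B hp).2.1
  case end_B =>
    intro i p hik hp
    obtain ⟨_, h1, h2⟩ := mem_B hp
    split_ifs at h2 <;> omega
  case card_B => exact fun hi hik => by rw [card_packetsOf, count_tripleB hh hi hik]
  case r_one => exact rIdx_one k h
  case r_succ => exact rIdx_succ
  case F_one => simp
  case F_succ =>
    intro i hi
    obtain ⟨m, rfl⟩ : ∃ m, i = m + 1 := ⟨i - 1, by omega⟩
    simp only [Nat.add_sub_cancel]
    ring
  case two_mul_a_le => exact two_mul_sizeA_le
  case two_le_a => exact fun _ hik => hh.trans (le_sizeA hik)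
  case a_eq => exact fun _ hik => sizeA_eq_two_mul hik

/-- For all integers `k ≥ 2` and `h ≥ 2`, and any tie-breaking rule for
Greedy (i.e. any schedule `S` that Greedy can produce on `I_k^h`), the maximum flow time
of Greedy's schedule on the instance `I_k^h` equals `(2^k − 1)·h − 1`. -/
theorem greedy_cost_Ikh (k h : ℕ) (hk : 2 ≤ k) (hh : 2 ≤ h)
    (S : PInstance.Sched (Ikh k h)) (hG : (Ikh k h).IsGreedy S) :
    (Ikh k h).cost S = (2 ^ k - 1) * h - 1 := by
  rw [(isChain_Ikh hk hh).cost_eq hG hk, sizeA, if_pos (by omega), Nat.sub_self, pow_zero,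
    one_mul, Nat.sub_mul, one_mul, ← mul_assoc, ← pow_succ', Nat.sub_add_cancel (by omega)]
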